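/- arXiv:1804.01677 — 2 statements merged into one kernel-verified Lean document; each statement's English description precedes it below -/
import Mathlib

section
/- Let H ∈ (1/2, 1), let (B^H_t)_{t≥0} be a fractional Brownian motion with Hurst index H having continuous sample paths, and let k > 0, a ∈ ℝ, σ > 0, Y₀ > 0. Then for almost every ω the following holds: every continuous function Y : [0,∞) → ℝ with Y(0) = Y₀ which satisfies Y(t) = Y₀ + (1/2)∫₀ᵗ (k/Y(s) − a·Y(s)) ds + (σ/2)·B^H_t(ω) for every t ≥ 0 with inf_{s∈[0,t]} Y(s) > 0, is strictly positive for all t ≥ 0. Consequently the fractional Cox–Ingersoll–Ross process X_t = Y_t² never hits zero almost surely. -/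
open MeasureTheory
open scoped ProbabilityTheory

/-- A fractional Brownian motion with Hurst index `H ∈ (0,1)` on a probability space `Ω`:
a measurable-in-`ω`, centered Gaussian process `B` (every finite linear combination of
values at nonnegative times is Gaussian) with `B 0 = 0` a.s. and covariance
`E[B s · B t] = (s^{2H} + t^{2H} − |t − s|^{2H})/2` for `s, t ≥ 0`. -/
def IsFractionalBrownianMotion {Ω : Type*} [MeasureSpace Ω] (H : ℝ) (B : ℝ → Ω → ℝ) :
    Prop :=
  (∀ t : ℝ, 0 ≤ t → Measurable (B t)) ∧
  (∀ (n : ℕ) (t : Fin n → ℝ) (c : Fin n → ℝ), (∀ i, 0 ≤ t i) →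
    ∃ (m : ℝ) (v : NNReal),
      Measure.map (fun ω => ∑ i, c i * B (t i) ω) ℙ = ProbabilityTheory.gaussianReal m v) ∧
  (∀ᵐ ω, B 0 ω = 0) ∧
  (∀ t : ℝ, 0 ≤ t → ∫ ω, B t ω = 0) ∧
  (∀ s t : ℝ, 0 ≤ s → 0 ≤ t →
    ∫ ω, B s ω * B t ω = (s ^ (2 * H) + t ^ (2 * H) - |t - s| ^ (2 * H)) / 2)

lemma holder_of_dyadic (b : ℝ → ℝ) (hb : Continuous b) (r : ℝ) (hr0 : 0 < r) (hr1 : r < 1)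
    (h : ∀ᶠ n : ℕ in Filter.atTop, ∀ j < 4 ^ n,
      |b (((j + 1 : ℕ) : ℝ) / 2 ^ n) - b ((j : ℝ) / 2 ^ n)| ≤ r ^ n) (τ : ℝ) (hτ : 0 ≤ τ) :
    ∃ K > 0, ∀ᶠ n : ℕ in Filter.atTop, ∀ s, 0 ≤ s → s ≤ τ → τ - s ≤ (1 / 2) ^ n →
      |b s - b τ| ≤ K * r ^ n := by
  have h2 : ∀ᶠ n : ℕ in Filter.atTop, τ < 2 ^ n :=
    (tendsto_pow_atTop_atTop_of_one_lt (by norm_num : (1:ℝ) < 2)).eventually_gt_atTop τ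
  obtain ⟨N, hN⟩ := Filter.eventually_atTop.1 (h.and h2)
  have hfl : ∀ n ≥ N, ∀ x, 0 ≤ x → x ≤ τ → ⌊x * 2 ^ n⌋₊ < 4 ^ n := by
    intro n hn x hx hxt
    rw [Nat.floor_lt (by positivity)]
    push_cast
    have : (4:ℝ) ^ n = 2 ^ n * 2 ^ n := by rw [← mul_pow]; norm_num
    rw [this]
    have := (hN n hn).2
    gcongr
    linarith
  have key : ∀ x, 0 ≤ x → x ≤ τ → ∀ n ≥ N,
      |b ((⌊x * 2 ^ n⌋₊ : ℝ) / 2 ^ n) - b x| ≤ r / (1 - r) * r ^ n := by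
    intro x hx hxt n hn
    obtain ⟨m, rfl⟩ := Nat.exists_eq_add_of_le hn
    have hlim : Filter.Tendsto (fun m : ℕ => b ((⌊x * 2 ^ (N + m)⌋₊ : ℝ) / 2 ^ (N + m)))
        Filter.atTop (nhds (b x)) := by
      apply (hb.tendsto x).comp
      have h1 := tendsto_nat_floor_mul_div_atTop (R := ℝ) hx
      have h3 : Filter.Tendsto (fun m : ℕ => (2:ℝ) ^ (N + m)) Filter.atTop Filter.atTop :=
        (tendsto_pow_atTop_atTop_of_one_lt (by norm_num : (1:ℝ) < 2)).comp
          (Filter.tendsto_atTop_mono (fun m => Nat.le_add_left m N) Filter.tendsto_id)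
      exact h1.comp h3
    have hstep : ∀ m : ℕ, dist (b ((⌊x * 2 ^ (N + m)⌋₊ : ℝ) / 2 ^ (N + m)))
        (b ((⌊x * 2 ^ (N + (m + 1))⌋₊ : ℝ) / 2 ^ (N + (m + 1)))) ≤ (r ^ (N + 1)) * r ^ m := by
      intro m
      set f := ⌊x * 2 ^ (N + m)⌋₊ with hf
      set g := ⌊x * 2 ^ (N + (m + 1))⌋₊ with hg
      have e1 : (f : ℝ) ≤ x * 2 ^ (N + m) := Nat.floor_le (by positivity)
      have e2 : x * 2 ^ (N + m) < f + 1 := Nat.lt_floor_add_one _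
      have e3 : x * 2 ^ (N + (m + 1)) = 2 * (x * 2 ^ (N + m)) := by ring
      have g1 : 2 * f ≤ g := by
        rw [hg]; apply Nat.le_floor; push_cast; rw [e3]; linarith
      have g2 : g < 2 * f + 2 := by
        rw [hg, Nat.floor_lt (by positivity)]; push_cast; rw [e3]; linarith
      have hq : (f : ℝ) / 2 ^ (N + m) = ((2 * f : ℕ) : ℝ) / 2 ^ (N + (m + 1)) := by
        push_cast; rw [← add_assoc, pow_succ]; field_simp
      have hlt := hfl (N + (m + 1)) (by omega) x hx hxt
      rw [← hg] at hlt
      rw [hq, dist_comm, Real.dist_eq]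
      have hp : r ^ (N + 1) * r ^ m = r ^ (N + (m + 1)) := by ring
      rw [hp]
      rcases (by omega : g = 2 * f ∨ g = 2 * f + 1) with hh | hh
      · rw [hh]; simp; positivity
      · rw [hh]; exact (hN (N + (m + 1)) (by omega)).1 (2 * f) (by omega)
    have := dist_le_of_le_geometric_of_tendsto r (r ^ (N + 1)) hr1 hstep hlim m
    rw [Real.dist_eq] at this
    refine this.trans (le_of_eq ?_)
    ring
  have h1r : 0 < 1 - r := by linarith
  refine ⟨2 * (r / (1 - r)) + 1, by positivity, Filter.eventually_atTop.2 ⟨N, ?_⟩⟩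
  intro n hn s hs hst hd
  have k1 := key s hs hst n hn
  have k2 := key τ hτ le_rfl n hn
  have k3 : |b ((⌊τ * 2 ^ n⌋₊ : ℝ) / 2 ^ n) - b ((⌊s * 2 ^ n⌋₊ : ℝ) / 2 ^ n)| ≤ r ^ n := by
    have hd' : τ * 2 ^ n ≤ s * 2 ^ n + 1 := by
      have : (1 / 2 : ℝ) ^ n * 2 ^ n = 1 := by rw [← mul_pow]; norm_num
      nlinarith [pow_pos (by norm_num : (0:ℝ) < 2) n]
    have g1 : ⌊s * 2 ^ n⌋₊ ≤ ⌊τ * 2 ^ n⌋₊ := by gcongr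
    have g2 : ⌊τ * 2 ^ n⌋₊ ≤ ⌊s * 2 ^ n⌋₊ + 1 := by
      rw [← Nat.floor_add_one (by positivity)]; gcongr
    rcases (by omega : ⌊τ * 2 ^ n⌋₊ = ⌊s * 2 ^ n⌋₊ ∨ ⌊τ * 2 ^ n⌋₊ = ⌊s * 2 ^ n⌋₊ + 1) with hh | hh
    · rw [hh]; simp; positivity
    · rw [hh]; exact (hN n hn).1 _ (hfl n hn s hs hst)
  rw [abs_le] at *
  constructor <;> nlinarith

lemma pos_of_holder (b : ℝ → ℝ) (hb : Continuous b) (r : ℝ) (hr0 : 0 < r) (hr2 : 2 * r ^ 2 < 1)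
    (h : ∀ τ, 0 ≤ τ → ∃ K > 0, ∀ᶠ n : ℕ in Filter.atTop, ∀ s, 0 ≤ s → s ≤ τ →
      τ - s ≤ (1 / 2) ^ n → |b s - b τ| ≤ K * r ^ n)
    (k a σ Y₀ : ℝ) (hk : 0 < k) (hσ : 0 < σ) (hY₀ : 0 < Y₀) (Y : ℝ → ℝ)
    (hY : ContinuousOn Y (Set.Ici 0)) (hY0 : Y 0 = Y₀)
    (heq : ∀ t : ℝ, 0 ≤ t → 0 < sInf (Y '' Set.Icc 0 t) →
        Y t = Y₀ + (1 / 2) * (∫ s in (0:ℝ)..t, (k / Y s - a * Y s)) + (σ / 2) * b t) :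
    ∀ t : ℝ, 0 ≤ t → 0 < Y t := by
  by_contra hcon
  push Not at hcon
  obtain ⟨t₀, ht₀, hYt₀⟩ := hcon
  have hScl : IsClosed (Set.Ici (0:ℝ) ∩ Y ⁻¹' Set.Iic 0) :=
    hY.preimage_isClosed_of_isClosed isClosed_Ici isClosed_Iic
  have hSne : (Set.Ici (0:ℝ) ∩ Y ⁻¹' Set.Iic 0).Nonempty := ⟨t₀, ht₀, hYt₀⟩
  have hSbd : BddBelow (Set.Ici (0:ℝ) ∩ Y ⁻¹' Set.Iic 0) := ⟨0, fun x hx => hx.1⟩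
  obtain ⟨τ, hτdef⟩ : ∃ τ, τ = sInf (Set.Ici (0:ℝ) ∩ Y ⁻¹' Set.Iic 0) := ⟨_, rfl⟩
  have hτmem := hScl.csInf_mem hSne hSbd
  rw [← hτdef] at hτmem
  have hτ0 : 0 ≤ τ := hτmem.1
  have hYτ : Y τ ≤ 0 := hτmem.2
  have hpos : ∀ s, 0 ≤ s → s < τ → 0 < Y s := by
    intro s hs hst
    by_contra hc
    have := csInf_le hSbd (a := s) ⟨hs, not_lt.1 hc⟩
    rw [← hτdef] at this
    linarith
  have hτpos : 0 < τ := by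
    rcases hτ0.lt_or_eq with h1 | h1
    · exact h1
    · rw [← h1] at hYτ; linarith
  have hnhds : nhdsWithin τ (Set.Iio τ) ≤ nhds τ := nhdsWithin_le_nhds
  have hYcont : ContinuousAt Y τ := hY.continuousAt (Ici_mem_nhds hτpos)
  have hYτ0 : Y τ = 0 := by
    apply le_antisymm hYτ
    apply ge_of_tendsto (hYcont.tendsto.mono_left hnhds)
    filter_upwards [self_mem_nhdsWithin, hnhds (Ici_mem_nhds hτpos)] with x hx hx0
    exact (hpos x hx0 hx).le
  have heq' : ∀ t, 0 ≤ t → t < τ → 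
      Y t = Y₀ + (1 / 2) * (∫ s in (0:ℝ)..t, (k / Y s - a * Y s)) + (σ / 2) * b t := by
    intro t ht htτ
    apply heq t ht
    have hc : IsCompact (Y '' Set.Icc 0 t) :=
      isCompact_Icc.image_of_continuousOn (hY.mono Set.Icc_subset_Ici_self)
    obtain ⟨x, hx, hxe⟩ := hc.sInf_mem ((Set.nonempty_Icc.2 ht).image Y)
    rw [← hxe]
    exact hpos x hx.1 (hx.2.trans_lt htτ)
  have hint : ∀ s t, 0 ≤ s → s < τ → 0 ≤ t → t < τ →
      IntervalIntegrable (fun s => k / Y s - a * Y s) volume s t := by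
    intro s t hs hs' ht ht'
    apply ContinuousOn.intervalIntegrable
    have hsub : ∀ x ∈ Set.uIcc s t, 0 ≤ x ∧ x < τ := by
      intro x hx
      rw [Set.mem_uIcc] at hx
      rcases hx with hx | hx <;> constructor <;> linarith [hx.1, hx.2]
    have hY' : ContinuousOn Y (Set.uIcc s t) := hY.mono (fun x hx => (hsub x hx).1)
    exact (continuousOn_const.div hY' (fun x hx => (hpos x (hsub x hx).1 (hsub x hx).2).ne')).sub
      (continuousOn_const.mul hY')
  have claim : ∀ s L, 0 ≤ s → s < τ → (∀ u, s ≤ u → u < τ → L ≤ k / Y u - a * Y u) →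
      Y s + (τ - s) * L / 2 + σ / 2 * (b τ - b s) ≤ 0 := by
    intro s L hs hsτ hL
    have hlim1 : Filter.Tendsto (fun t => Y s + (t - s) * L / 2 + σ / 2 * (b t - b s))
        (nhdsWithin τ (Set.Iio τ)) (nhds (Y s + (τ - s) * L / 2 + σ / 2 * (b τ - b s))) := by
      have : Continuous (fun t => Y s + (t - s) * L / 2 + σ / 2 * (b t - b s)) := by fun_prop
      exact (this.tendsto τ).mono_left hnhds
    rw [← hYτ0]
    apply le_of_tendsto_of_tendsto hlim1 (hYcont.tendsto.mono_left hnhds)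
    filter_upwards [self_mem_nhdsWithin, hnhds (Ici_mem_nhds hsτ)] with t ht hst
    have hst : s ≤ t := hst
    have ht : t < τ := ht
    have ht0 : 0 ≤ t := hs.trans hst
    have e1 := heq' s hs hsτ
    have e2 := heq' t ht0 ht
    have e3 := intervalIntegral.integral_add_adjacent_intervals
      (hint 0 s le_rfl hτpos hs hsτ) (hint s t hs hsτ ht0 ht)
    have e4 : (t - s) * L ≤ ∫ u in s..t, (k / Y u - a * Y u) := by
      have := intervalIntegral.integral_mono_on hst
        (intervalIntegrable_const (μ := volume) (c := L)) (hint s t hs hsτ ht0 ht)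
        (fun u hu => hL u hu.1 (hu.2.trans_lt ht))
      simpa using this
    rw [← e3] at e2
    linarith
  obtain ⟨K, hK, hKev⟩ := h τ hτ0
  -- near τ, drift ≥ k / (2 Y)
  have hnear : ∀ᶠ x in nhds τ, a * Y x ^ 2 < k / 2 ∧ 0 ≤ x := by
    have : Filter.Tendsto (fun x => a * Y x ^ 2) (nhds τ) (nhds (a * Y τ ^ 2)) :=
      (hYcont.tendsto.pow 2).const_mul a
    rw [hYτ0] at this
    filter_upwards [this.eventually_lt_const (by simpa using half_pos hk : a * 0 ^ 2 < k / 2),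
      Ici_mem_nhds hτpos] with x h1 h2
    exact ⟨h1, h2⟩
  obtain ⟨δ, hδ, hδ'⟩ := Metric.eventually_nhds_iff.1 hnear
  have hdr : ∀ u, τ - δ < u → u < τ → k / 2 / Y u ≤ k / Y u - a * Y u := by
    intro u hu hu'
    have h1 := hδ' (y := u) (by rw [Real.dist_eq, abs_lt]; constructor <;> linarith)
    have hp := hpos u h1.2 hu'
    rw [div_le_iff₀ hp, sub_mul, div_mul_cancel₀ _ hp.ne']
    nlinarith [h1.1]
  have hdn : ∀ᶠ n : ℕ in Filter.atTop, ((1:ℝ) / 2) ^ n < min δ τ :=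
    (tendsto_pow_atTop_nhds_zero_of_lt_one (by norm_num) (by norm_num)).eventually_lt_const
      (lt_min hδ hτpos)
  have hrn : ∀ᶠ n : ℕ in Filter.atTop, 4 * (σ / 2 * K) ^ 2 * (2 * r ^ 2) ^ n < k := by
    have := (tendsto_pow_atTop_nhds_zero_of_lt_one (by positivity) hr2).const_mul
      (4 * (σ / 2 * K) ^ 2)
    rw [mul_zero] at this
    exact this.eventually_lt_const hk
  obtain ⟨n, hn1, hn2, hn3⟩ := (hKev.and (hdn.and hrn)).exists
  obtain ⟨d, hd⟩ : ∃ d, d = ((1:ℝ) / 2) ^ n := ⟨_, rfl⟩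
  rw [← hd] at hn1 hn2
  have hd0 : 0 < d := by rw [hd]; positivity
  have hdδ : d < δ := hn2.trans_le (min_le_left _ _)
  have hdτ : d < τ := hn2.trans_le (min_le_right _ _)
  obtain ⟨D, hD⟩ : ∃ D, D = σ / 2 * K := ⟨_, rfl⟩
  have hDp : 0 < D := by rw [hD]; positivity
  have hub : ∀ s, τ - d ≤ s → s < τ → σ / 2 * (b s - b τ) ≤ D * r ^ n := by
    intro s hs hs'
    have := (le_abs_self _).trans (hn1 s (by linarith) hs'.le (by linarith))
    rw [hD, mul_assoc]
    gcongr
  have hYub : ∀ s, τ - d ≤ s → s < τ → Y s ≤ D * r ^ n := by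
    intro s hs hs'
    have h1 := claim s 0 (by linarith) hs' (fun u hu hu' => by
      refine le_trans ?_ (hdr u (by linarith) hu')
      have := hpos u (by linarith) hu'
      positivity)
    have h2 := hub s hs hs'
    linarith
  have hfin := claim (τ - d) (k / 2 / (D * r ^ n)) (by linarith) (by linarith)
    (fun u hu hu' => by
      refine le_trans ?_ (hdr u (by linarith) hu')
      have := hpos u (by linarith) hu'
      have := hYub u hu hu'
      gcongr)
  have h2 := hub (τ - d) le_rfl (by linarith)
  have h3 := hpos (τ - d) (by linarith) (by linarith)
  have h4 : d * (k / 2 / (D * r ^ n)) / 2 ≤ D * r ^ n := by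
    have : τ - (τ - d) = d := by ring
    rw [this] at hfin
    linarith
  have hrnp : 0 < D * r ^ n := by positivity
  have h5 : d * k ≤ 4 * (D * r ^ n) ^ 2 := by
    have : d * (k / 2 / (D * r ^ n)) / 2 = d * k / 4 / (D * r ^ n) := by ring
    rw [this, div_le_iff₀ hrnp] at h4
    nlinarith
  have h6 : d * 2 ^ n = 1 := by rw [hd, ← mul_pow]; norm_num
  have h7 : k ≤ 4 * D ^ 2 * (2 * r ^ 2) ^ n := by
    have : k = d * k * 2 ^ n := by rw [mul_right_comm, h6, one_mul]
    rw [this]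
    calc d * k * 2 ^ n ≤ 4 * (D * r ^ n) ^ 2 * 2 ^ n := by gcongr
      _ = _ := by rw [mul_pow 2, ← pow_mul, mul_comm 2 n, pow_mul]; ring
  rw [hD] at h7
  linarith

lemma fbm_incr {Ω : Type*} [MeasureSpace Ω] [IsProbabilityMeasure (ℙ : Measure Ω)]
    (H : ℝ) (hH : 1 / 2 < H) (B : ℝ → Ω → ℝ) (hB : IsFractionalBrownianMotion H B)
    (s t : ℝ) (hs : 0 ≤ s) (ht : 0 ≤ t) :
    Measure.map (fun ω => B t ω - B s ω) ℙ =
      Measure.map (fun x => |t - s| ^ H * x) (ProbabilityTheory.gaussianReal 0 1) := by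
  obtain ⟨hm, hg, -, hmean, hcov⟩ := hB
  have hL2 : ∀ u, 0 ≤ u → MemLp (B u) 2 ℙ := by
    intro u hu
    obtain ⟨m, v, h⟩ := hg 1 (fun _ => u) (fun _ => 1) (fun _ => hu)
    simp only [Finset.univ_unique, Finset.sum_const, Finset.card_singleton, one_smul, one_mul] at h
    have h2 := ProbabilityTheory.memLp_id_gaussianReal (μ := m) (v := v) 2
    rw [← h] at h2
    exact (memLp_map_measure_iff aestronglyMeasurable_id (hm u hu).aemeasurable).1 h2
  obtain ⟨m, v, h⟩ := hg 2 ![t, s] ![1, -1] (by intro i; fin_cases i <;> simp [hs, ht])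
  have hfun : (fun ω => ∑ i, (![1, -1] : Fin 2 → ℝ) i * B ((![t, s] : Fin 2 → ℝ) i) ω)
      = fun ω => B t ω - B s ω := by
    funext ω; simp [Fin.sum_univ_two]; ring
  rw [hfun] at h
  have hmeas : Measurable (fun ω => B t ω - B s ω) := (hm t ht).sub (hm s hs)
  have hI : ∀ u, 0 ≤ u → Integrable (B u) ℙ := fun u hu => (hL2 u hu).integrable (by norm_num)
  have hm0 : m = 0 := by
    have e := ProbabilityTheory.integral_id_gaussianReal (μ := m) (v := v)
    rw [← h, integral_map hmeas.aemeasurable (by fun_prop),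
      integral_sub (hI t ht) (hI s hs), hmean t ht, hmean s hs] at e
    simpa using e.symm
  subst hm0
  have hv : (v : ℝ) = |t - s| ^ (2 * H) := by
    have e := ProbabilityTheory.variance_fun_id_gaussianReal (μ := 0) (v := v)
    rw [ProbabilityTheory.variance_of_integral_eq_zero (by fun_prop)
      ProbabilityTheory.integral_id_gaussianReal, ← h,
      integral_map hmeas.aemeasurable (by fun_prop)] at e
    rw [← e]
    have i1 : Integrable (fun ω => B t ω * B t ω) ℙ := (hL2 t ht).integrable_mul (hL2 t ht)
    have i2 : Integrable (fun ω => B s ω * B t ω) ℙ := (hL2 s hs).integrable_mul (hL2 t ht)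
    have i3 : Integrable (fun ω => B s ω * B s ω) ℙ := (hL2 s hs).integrable_mul (hL2 s hs)
    have : (fun ω => (B t ω - B s ω) ^ 2) = fun ω => B t ω * B t ω - 2 * (B s ω * B t ω)
        + B s ω * B s ω := by funext ω; ring
    have i4 : Integrable (fun ω => B t ω * B t ω - 2 * (B s ω * B t ω)) ℙ :=
      i1.sub (i2.const_mul 2)
    rw [this, integral_add i4 i3, integral_sub i1 (i2.const_mul 2),
      integral_const_mul, hcov t t ht ht, hcov s t hs ht, hcov s s hs hs]
    have : (0:ℝ) ^ (2 * H) = 0 := Real.zero_rpow (by linarith)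
    simp [this]
    ring
  rw [h, ProbabilityTheory.gaussianReal_map_const_mul]
  congr 1
  · simp
  · ext
    simp only [NNReal.coe_mul, NNReal.coe_mk, NNReal.coe_one, mul_one]
    rw [hv, ← Real.rpow_natCast, ← Real.rpow_mul (abs_nonneg _)]
    congr 1; push_cast; ring

/-- Dyadic increments are eventually bounded. -/
lemma fbm_dyadic {Ω : Type*} [MeasureSpace Ω] [IsProbabilityMeasure (ℙ : Measure Ω)]
    (H : ℝ) (hH : 1 / 2 < H) (B : ℝ → Ω → ℝ) (hB : IsFractionalBrownianMotion H B)
    (γ : ℝ) (hγ : γ < H) :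
    ∀ᵐ ω, ∀ᶠ n : ℕ in Filter.atTop, ∀ j < 4 ^ n,
      |B (((j + 1 : ℕ) : ℝ) / 2 ^ n) ω - B ((j : ℝ) / 2 ^ n) ω| ≤ ((2:ℝ) ^ (-γ)) ^ n := by
  obtain ⟨p, hp⟩ := exists_nat_ge (3 / (H - γ))
  have hp3 : 3 ≤ p * (H - γ) := by rwa [div_le_iff₀ (by linarith)] at hp
  have hIp : Integrable (fun x : ℝ => |x| ^ p) (ProbabilityTheory.gaussianReal 0 1) := by
    have := (ProbabilityTheory.memLp_id_gaussianReal (μ := 0) (v := 1) (p : NNReal))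
    exact this.integrable_norm_pow'
  obtain ⟨M, hM⟩ : ∃ M, M = ∫ x : ℝ, |x| ^ p ∂(ProbabilityTheory.gaussianReal 0 1) := ⟨_, rfl⟩
  have hM0 : 0 ≤ M := by rw [hM]; exact integral_nonneg (fun x => by positivity)
  have hone : ∀ (n j : ℕ), (ℙ : Measure Ω) {ω | ((2:ℝ) ^ (-γ)) ^ n <
      |B (((j + 1 : ℕ) : ℝ) / 2 ^ n) ω - B ((j : ℝ) / 2 ^ n) ω|} ≤
      ENNReal.ofReal (M * (1 / 8) ^ n) := by
    intro n j
    have hjm : 0 ≤ (j : ℝ) / 2 ^ n := by positivity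
    have hjm' : 0 ≤ ((j + 1 : ℕ) : ℝ) / 2 ^ n := by positivity
    have hlaw := fbm_incr H hH B hB _ _ hjm hjm'
    have hdiff : |((j + 1 : ℕ) : ℝ) / 2 ^ n - (j : ℝ) / 2 ^ n| = ((2:ℝ) ^ n)⁻¹ := by
      have : ((j + 1 : ℕ) : ℝ) / 2 ^ n - (j : ℝ) / 2 ^ n = ((2:ℝ) ^ n)⁻¹ := by
        push_cast; field_simp; ring
      rw [this, abs_of_pos (by positivity)]
    rw [hdiff] at hlaw
    have hmeas : Measurable (fun ω => B (((j + 1 : ℕ) : ℝ) / 2 ^ n) ω - B ((j : ℝ) / 2 ^ n) ω) :=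
      (hB.1 _ hjm').sub (hB.1 _ hjm)
    have hset : MeasurableSet {y : ℝ | ((2:ℝ) ^ (-γ)) ^ n < |y|} :=
      measurableSet_lt measurable_const (by fun_prop)
    have e1 : (ℙ : Measure Ω) {ω | ((2:ℝ) ^ (-γ)) ^ n <
      |B (((j + 1 : ℕ) : ℝ) / 2 ^ n) ω - B ((j : ℝ) / 2 ^ n) ω|} =
      ProbabilityTheory.gaussianReal 0 1
        {x | ((2:ℝ) ^ (-γ)) ^ n < |(((2:ℝ) ^ n)⁻¹) ^ H * x|} := by
      have := congrArg (fun μ => μ {y : ℝ | ((2:ℝ) ^ (-γ)) ^ n < |y|}) hlaw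
      rw [Measure.map_apply hmeas hset, Measure.map_apply (by fun_prop) hset] at this
      exact this
    rw [e1]
    obtain ⟨q, hq⟩ : ∃ q, q = (2:ℝ) ^ (n * (H - γ)) := ⟨_, rfl⟩
    have hq0 : 0 < q := by rw [hq]; positivity
    have hsub : {x : ℝ | ((2:ℝ) ^ (-γ)) ^ n < |(((2:ℝ) ^ n)⁻¹) ^ H * x|} ⊆
        {x : ℝ | q ^ p ≤ |x| ^ p} := by
      intro x hx
      simp only [Set.mem_ofPred_eq] at hx ⊢
      apply pow_le_pow_left₀ hq0.le
      have e2 : ((2:ℝ) ^ (-γ)) ^ n = q * (((2:ℝ) ^ n)⁻¹) ^ H := by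
        rw [hq, ← Real.rpow_natCast, ← Real.rpow_mul (by norm_num), ← Real.rpow_natCast,
          ← Real.rpow_neg (by norm_num), ← Real.rpow_mul (by norm_num),
          ← Real.rpow_add (by norm_num)]
        congr 1; ring
      have hc : 0 < (((2:ℝ) ^ n)⁻¹) ^ H := by positivity
      rw [abs_mul, abs_of_pos hc, e2, mul_comm] at hx
      exact (lt_of_mul_lt_mul_left hx hc.le).le
    refine (measure_mono hsub).trans ?_
    have hmk := mul_meas_ge_le_integral_of_nonneg (μ := ProbabilityTheory.gaussianReal 0 1)
      (f := fun x : ℝ => |x| ^ p) (Filter.Eventually.of_forall fun x => by positivity) hIp (q ^ p)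
    rw [← hM] at hmk
    rw [← ENNReal.ofReal_toReal (measure_ne_top (ProbabilityTheory.gaussianReal 0 1) _)]
    apply ENNReal.ofReal_le_ofReal
    have h8 : (8:ℝ) ^ n ≤ q ^ p := by
      rw [hq, ← Real.rpow_natCast, ← Real.rpow_natCast, ← Real.rpow_mul (by norm_num),
        show (8:ℝ) = 2 ^ (3:ℝ) by norm_num, ← Real.rpow_mul (by norm_num)]
      apply Real.rpow_le_rpow_of_exponent_le (by norm_num)
      nlinarith [(Nat.cast_nonneg n : (0:ℝ) ≤ n)]
    change (ProbabilityTheory.gaussianReal 0 1).real {x : ℝ | q ^ p ≤ |x| ^ p} ≤ _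
    have hR : 0 ≤ (ProbabilityTheory.gaussianReal 0 1).real {x : ℝ | q ^ p ≤ |x| ^ p} :=
      measureReal_nonneg
    rw [one_div, inv_pow, ← div_eq_mul_inv, le_div_iff₀ (by positivity), mul_comm]
    exact (mul_le_mul_of_nonneg_right h8 hR).trans hmk
  have hbad : ∀ n : ℕ, (ℙ : Measure Ω) (⋃ j ∈ Finset.range (4 ^ n), {ω | ((2:ℝ) ^ (-γ)) ^ n <
      |B (((j + 1 : ℕ) : ℝ) / 2 ^ n) ω - B ((j : ℝ) / 2 ^ n) ω|}) ≤
      ENNReal.ofReal (M * (1 / 2) ^ n) := by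
    intro n
    refine (measure_biUnion_finset_le _ _).trans ?_
    refine (Finset.sum_le_sum fun j _ => hone n j).trans ?_
    rw [Finset.sum_const, Finset.card_range, ← ENNReal.ofReal_nsmul]
    apply ENNReal.ofReal_le_ofReal
    rw [nsmul_eq_mul]
    push_cast
    rw [mul_left_comm, ← mul_pow]
    norm_num
  have hsum : ∑' n : ℕ, (ℙ : Measure Ω) (⋃ j ∈ Finset.range (4 ^ n), {ω | ((2:ℝ) ^ (-γ)) ^ n <
      |B (((j + 1 : ℕ) : ℝ) / 2 ^ n) ω - B ((j : ℝ) / 2 ^ n) ω|}) ≠ ⊤ := by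
    refine ne_top_of_le_ne_top ?_ (ENNReal.tsum_le_tsum hbad)
    exact (summable_geometric_two.mul_left M).tsum_ofReal_ne_top
  filter_upwards [ae_eventually_notMem hsum] with ω hω
  filter_upwards [hω] with n hn j hj
  by_contra hc
  apply hn
  simp only [Set.mem_iUnion, Finset.mem_range]
  exact ⟨j, hj, not_le.1 hc⟩

/-- Theorem 3.2: for `H ∈ (1/2, 1)`, `k > 0`, `a ∈ ℝ`, `σ > 0`, `Y₀ > 0`,
almost surely every continuous function `Y` on `[0,∞)` with `Y 0 = Y₀` satisfying the
integral equation `Y t = Y₀ + (1/2)∫₀ᵗ (k/Y(s) − a Y(s)) ds + (σ/2) B^H_t(ω)` for every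
`t ≥ 0` with `inf_{s∈[0,t]} Y s > 0` is strictly positive for all `t ≥ 0`; consequently
the fractional CIR process `X = Y²` never hits zero a.s. -/
theorem fCIR_never_hits_zero_as (Ω : Type*) [MeasureSpace Ω]
    [IsProbabilityMeasure (ℙ : Measure Ω)]
    (H : ℝ) (hH : 1 / 2 < H) (hH1 : H < 1) (B : ℝ → Ω → ℝ)
    (hB : IsFractionalBrownianMotion H B)
    (hBcont : ∀ ω, Continuous fun t => B t ω)
    (k a σ Y₀ : ℝ) (hk : 0 < k) (hσ : 0 < σ) (hY₀ : 0 < Y₀) :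
    ∀ᵐ ω, ∀ Y : ℝ → ℝ, ContinuousOn Y (Set.Ici 0) → Y 0 = Y₀ →
      (∀ t : ℝ, 0 ≤ t → 0 < sInf (Y '' Set.Icc 0 t) →
        Y t = Y₀ + (1 / 2) * (∫ s in (0:ℝ)..t, (k / Y s - a * Y s)) + (σ / 2) * B t ω) →
      ∀ t : ℝ, 0 ≤ t → 0 < Y t := by
  obtain ⟨γ, hγ1, hγ2⟩ := exists_between hH
  have hr0 : (0:ℝ) < 2 ^ (-γ) := by positivity
  have hr1 : (2:ℝ) ^ (-γ) < 1 := Real.rpow_lt_one_of_one_lt_of_neg (by norm_num) (by linarith)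
  have hr2 : 2 * ((2:ℝ) ^ (-γ)) ^ 2 < 1 := by
    have : 2 * ((2:ℝ) ^ (-γ)) ^ 2 = 2 ^ (1 - 2 * γ) := by
      rw [← Real.rpow_natCast, ← Real.rpow_mul (by norm_num), sub_eq_add_neg,
        Real.rpow_add (by norm_num), Real.rpow_one]
      congr 2; push_cast; ring
    rw [this]
    exact Real.rpow_lt_one_of_one_lt_of_neg (by norm_num) (by linarith)
  filter_upwards [fbm_dyadic H hH B hB γ hγ2] with ω hω Y hY hY0 heq
  exact pos_of_holder (fun t => B t ω) (hBcont ω) _ hr0 hr2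
    (holder_of_dyadic (fun t => B t ω) (hBcont ω) _ hr0 hr1 hω) k a σ Y₀ hk hσ hY₀ Y hY hY0 heq
end

section
/- Let λ ∈ (1/2, 1), k > 0 and c > 0. Then there exists ε* > 0 such that for every ε ∈ (0, ε*) and every x ≥ 0 one has (k/(4ε))·x − c·x^λ + ε > 0. -/
/-- Let λ ∈ (1/2, 1), k > 0 and c > 0. Then there exists ε* > 0 such that
for every ε ∈ (0, ε*) and every x ≥ 0 one has (k/(4ε))·x − c·x^λ + ε > 0. -/
theorem fCIR_key_function_positive (l k c : ℝ) (hl : 1/2 < l) (hl1 : l < 1)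
    (hk : 0 < k) (hc : 0 < c) :
    ∃ εstar : ℝ, 0 < εstar ∧ ∀ ε : ℝ, 0 < ε → ε < εstar → ∀ x : ℝ, 0 ≤ x →
      0 < (k / (4 * ε)) * x - c * x ^ l + ε := by
  have hd : 0 < 2 * l - 1 := by linarith
  have hK : 0 < (k / 4) ^ l / c := by positivity
  refine ⟨((k / 4) ^ l / c) ^ (1 / (2 * l - 1)), by positivity, ?_⟩
  intro ε hε hlt x hx
  have h1 : ε ^ (2 * l - 1) < (k / 4) ^ l / c := by
    have h := Real.rpow_lt_rpow hε.le hlt hd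
    rwa [← Real.rpow_mul hK.le, one_div_mul_cancel hd.ne', Real.rpow_one] at h
  have hA : 0 ≤ k / (4 * ε) * x := by positivity
  have hag := Real.geom_mean_le_arith_mean2_weighted (w₁ := l) (w₂ := 1 - l)
    (by linarith) (by linarith) hA hε.le (by ring)
  have hdp : 0 < ε ^ (2 * l - 1) := by positivity
  have heq : (k / (4 * ε) * x) ^ l * ε ^ (1 - l) = (k / 4) ^ l / ε ^ (2 * l - 1) * x ^ l := by
    have e1 : k / (4 * ε) * x = (k / 4) * x / ε := by field_simp
    have e2 : ε ^ l = ε ^ (2 * l - 1) * ε ^ (1 - l) := by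
      rw [← Real.rpow_add hε]; congr 1; ring
    have e3 : 0 < ε ^ (1 - l) := by positivity
    rw [e1, Real.div_rpow (by positivity) hε.le, Real.mul_rpow (by positivity) hx, e2]
    field_simp
  have h2 : c ≤ (k / 4) ^ l / ε ^ (2 * l - 1) := by
    rw [le_div_iff₀ hdp]
    rw [lt_div_iff₀ hc] at h1
    linarith
  have h3 := mul_le_mul_of_nonneg_right h2 (Real.rpow_nonneg hx l)
  rw [heq] at hag
  nlinarith [mul_nonneg (sub_nonneg.2 hl1.le) hA, mul_pos (show 0 < l by linarith) hε]
end
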